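/- Let r ≥ 13 be an integer and let G be an r-minimal graph. Then no two adjacent vertices of G both have degree at most 5; that is, for every edge uv of G, max{d_G(u), d_G(v)} ≥ 6. -/

import Mathlib

/-- A total `k`-coloring of a simple graph `G`: colors from `Fin k` are assigned to all
vertices and to all edges so that adjacent vertices get distinct colors, distinct edges
sharing an endpoint get distinct colors, and each edge gets a color distinct from the
colors of both of its endpoints. -/
def HasTotalColoring {V : Type*} (G : SimpleGraph V) (k : ℕ) : Prop :=
  ∃ (cV : V → Fin k) (cE : Sym2 V → Fin k),
    (∀ u v : V, G.Adj u v → cV u ≠ cV v) ∧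
    (∀ e₁ ∈ G.edgeSet, ∀ e₂ ∈ G.edgeSet, e₁ ≠ e₂ → (∃ x, x ∈ e₁ ∧ x ∈ e₂) →
      cE e₁ ≠ cE e₂) ∧
    (∀ e ∈ G.edgeSet, ∀ x ∈ e, cE e ≠ cV x)

/-- For `r ≥ 13`, a graph is `r`-minimal if it is a finite connected simple graph with
maximum degree at most `r` admitting no total `(r+2)`-coloring, such that deleting any
edge yields a graph admitting a total `(r+2)`-coloring. -/
def IsRMinimal {V : Type*} [Fintype V] (r : ℕ) (G : SimpleGraph V)
    [DecidableRel G.Adj] : Prop :=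
  G.Connected ∧ G.maxDegree ≤ r ∧ ¬ HasTotalColoring G (r + 2) ∧
    ∀ e ∈ G.edgeSet, HasTotalColoring (G.deleteEdges {e}) (r + 2)

/-- If two families indexed by finite sets have fewer members in total than there are colors,
some color is attained by neither. -/
theorem exists_color_avoiding {α β : Type*} {k : ℕ} (s : Finset α) (t : Finset β)
    (f : α → Fin k) (g : β → Fin k) (h : s.card + t.card < k) :
    ∃ c, (∀ x ∈ s, f x ≠ c) ∧ ∀ y ∈ t, g y ≠ c := by
  have hcard : (s.image f ∪ t.image g).card < (Finset.univ : Finset (Fin k)).card := by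
    have h₁ := Finset.card_union_le (s.image f) (t.image g)
    have h₂ : (s.image f).card ≤ s.card := Finset.card_image_le
    have h₃ : (t.image g).card ≤ t.card := Finset.card_image_le
    rw [Finset.card_univ, Fintype.card_fin]
    omega
  obtain ⟨c, -, hc⟩ := Finset.exists_mem_notMem_of_card_lt_card hcard
  simp only [Finset.mem_union, Finset.mem_image, not_or, not_exists, not_and] at hc
  exact ⟨c, hc.1, hc.2⟩

/-- Coloring an edge and then recoloring its two ends extends a total coloring of `G` minus the
edge to `G`, provided that the degrees of the ends are small compared to the number of colors. -/
theorem HasTotalColoring.of_deleteEdges {V : Type*} [Fintype V] {G : SimpleGraph V}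
    [DecidableRel G.Adj] {k : ℕ} {u v : V} (huv : G.Adj u v)
    (hu : G.degree u + G.degree u < k) (hv : G.degree v + G.degree v < k)
    (h : HasTotalColoring (G.deleteEdges {s(u, v)}) k) : HasTotalColoring G k := by
  classical
  obtain ⟨cV, cE, hV, hE, hI⟩ := h
  obtain ⟨a, hau, hav⟩ := exists_color_avoiding (G.neighborFinset u) (G.neighborFinset v)
    (fun w => cE s(u, w)) (fun w => cE s(v, w))
    (by simp only [SimpleGraph.card_neighborFinset_eq_degree]; omega)
  set cE' : Sym2 V → Fin k := Function.update cE s(u, v) a with hcE'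
  obtain ⟨b, hbV, hbE⟩ := exists_color_avoiding (G.neighborFinset u) (G.neighborFinset u)
    cV (fun w => cE' s(u, w)) (by simpa only [SimpleGraph.card_neighborFinset_eq_degree] using hu)
  set cV' : V → Fin k := Function.update cV u b with hcV'
  obtain ⟨c, hcV, hcE⟩ := exists_color_avoiding (G.neighborFinset v) (G.neighborFinset v)
    cV' (fun w => cE' s(v, w)) (by simpa only [SimpleGraph.card_neighborFinset_eq_degree] using hv)
  simp only [SimpleGraph.mem_neighborFinset] at hau hav hbV hbE hcV hcE
  simp only [SimpleGraph.edgeSet_deleteEdges, Set.mem_sdiff, Set.mem_singleton_iff] at hE hI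
  simp only [SimpleGraph.deleteEdges_adj, Set.mem_singleton_iff] at hV
  have hnew : ∀ e ∈ G.edgeSet, ∀ x, x ∈ e → x ∈ s(u, v) → cE e ≠ a := by
    intro e he x hx hxuv
    obtain ⟨w, rfl⟩ := Sym2.mem_iff_exists.mp hx
    rcases Sym2.mem_iff.mp hxuv with rfl | rfl
    · exact hau w he
    · exact hav w he
  refine ⟨Function.update cV' v c, cE', ?_, ?_, ?_⟩
  · intro x y hxy
    have hne := hxy.ne
    by_cases hxv : x = v
    · subst hxv
      rw [Function.update_self, Function.update_of_ne hne.symm]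
      exact (hcV y hxy).symm
    by_cases hyv : y = v
    · subst hyv
      rw [Function.update_self, Function.update_of_ne hne]
      exact hcV x hxy.symm
    rw [Function.update_of_ne hxv, Function.update_of_ne hyv]
    by_cases hxu : x = u
    · subst hxu
      rw [hcV', Function.update_self, Function.update_of_ne hne.symm]
      exact (hbV y hxy).symm
    by_cases hyu : y = u
    · subst hyu
      rw [hcV', Function.update_self, Function.update_of_ne hne]
      exact hbV x hxy.symm
    rw [hcV', Function.update_of_ne hxu, Function.update_of_ne hyu]
    refine hV x y ⟨hxy, fun he => ?_⟩
    have hx : x ∈ s(u, v) := he ▸ Sym2.mem_mk_left x y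
    exact (Sym2.mem_iff.mp hx).elim hxu hxv
  · rintro e₁ h₁ e₂ h₂ hne ⟨x, hx₁, hx₂⟩
    by_cases he₁ : e₁ = s(u, v)
    · subst he₁
      rw [hcE', Function.update_self, Function.update_of_ne hne.symm]
      exact (hnew e₂ h₂ x hx₂ hx₁).symm
    by_cases he₂ : e₂ = s(u, v)
    · subst he₂
      rw [hcE', Function.update_self, Function.update_of_ne hne]
      exact hnew e₁ h₁ x hx₁ hx₂
    rw [hcE', Function.update_of_ne he₁, Function.update_of_ne he₂]
    exact hE e₁ ⟨h₁, he₁⟩ e₂ ⟨h₂, he₂⟩ hne ⟨x, hx₁, hx₂⟩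
  · intro e he x hx
    by_cases hxv : x = v
    · subst hxv
      obtain ⟨w, rfl⟩ := Sym2.mem_iff_exists.mp hx
      rw [Function.update_self]
      exact hcE w he
    rw [Function.update_of_ne hxv]
    by_cases hxu : x = u
    · subst hxu
      obtain ⟨w, rfl⟩ := Sym2.mem_iff_exists.mp hx
      rw [hcV', Function.update_self]
      exact hbE w he
    have hne : e ≠ s(u, v) := by
      rintro rfl
      exact (Sym2.mem_iff.mp hx).elim hxu hxv
    rw [hcV', hcE', Function.update_of_ne hxu, Function.update_of_ne hne]
    exact hI e ⟨he, hne⟩ x hx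

/-- In an r-minimal graph (r ≥ 13), no two adjacent vertices both have
degree at most 5: for every edge uv, max{d_G(u), d_G(v)} ≥ 6. -/
theorem stmt_9 {V : Type*} [Fintype V] (r : ℕ) (hr : 13 ≤ r)
    (G : SimpleGraph V) [DecidableRel G.Adj] (hG : IsRMinimal r G) :
    ∀ u v : V, G.Adj u v → 6 ≤ max (G.degree u) (G.degree v) := by
  intro u v huv
  by_contra! hlt
  obtain ⟨hu, hv⟩ := max_lt_iff.mp hlt
  exact hG.2.2.1 (.of_deleteEdges huv (by omega) (by omega) (hG.2.2.2 s(u, v) huv))
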